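/- arXiv:2007.03917 — 2 statements merged into one kernel-verified Lean document; each statement's English description precedes it below -/
import Mathlib

section
/- Every Verma module V_{j,Δ} over A_k has finite length with at most three composition factors, and exactly one of these composition factors is infinite-dimensional over ℂ. -/
noncomputable section

namespace BP

/-- The free `ℂ`-algebra on four generators `J, G⁺, G⁻, L`. -/
abbrev F : Type := FreeAlgebra ℂ (Fin 4)

def jF : F := FreeAlgebra.ι ℂ 0
def gpF : F := FreeAlgebra.ι ℂ 1
def gmF : F := FreeAlgebra.ι ℂ 2
def lF : F := FreeAlgebra.ι ℂ 3

/-- `f_k(J, L) = 3J² − (k+3)L − (1/8)(k+1)(2k+3)·1`, as an element of the free algebra. -/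
def fF (k : ℂ) : F :=
  3 * jF ^ 2 - algebraMap ℂ F (k + 3) * lF - algebraMap ℂ F (1/8 * (k + 1) * (2*k + 3))

/-- The defining relations of `A_k`: `L` is central, `[J,G⁺] = G⁺`, `[J,G⁻] = −G⁻`,
`[G⁺,G⁻] = f_k(J,L)`. -/
inductive Rel (k : ℂ) : F → F → Prop
  | lj : Rel k (lF * jF) (jF * lF)
  | lgp : Rel k (lF * gpF) (gpF * lF)
  | lgm : Rel k (lF * gmF) (gmF * lF)
  | jgp : Rel k (jF * gpF - gpF * jF) gpF
  | jgm : Rel k (jF * gmF - gmF * jF) (-gmF)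
  | gpgm : Rel k (gpF * gmF - gmF * gpF) (fF k)

/-- The unital associative `ℂ`-algebra `A_k`: the quotient of the free algebra on
`J, G⁺, G⁻, L` by the two-sided ideal generated by the defining relations. -/
def A (k : ℂ) : Type := RingQuot (Rel k)

instance (k : ℂ) : Ring (A k) := inferInstanceAs (Ring (RingQuot (Rel k)))
instance (k : ℂ) : Algebra ℂ (A k) := inferInstanceAs (Algebra ℂ (RingQuot (Rel k)))

/-- The quotient map `F →ₐ[ℂ] A_k`. -/
def mk (k : ℂ) : F →ₐ[ℂ] A k := RingQuot.mkAlgHom ℂ (Rel k)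

/-- The generator `J` of `A_k`. -/
def J (k : ℂ) : A k := mk k jF
/-- The generator `G⁺` of `A_k`. -/
def Gp (k : ℂ) : A k := mk k gpF
/-- The generator `G⁻` of `A_k`. -/
def Gm (k : ℂ) : A k := mk k gmF
/-- The generator `L` of `A_k`. -/
def L (k : ℂ) : A k := mk k lF

/-- `f_k(x, y)` as a complex-valued function. -/
def fC (k x y : ℂ) : ℂ := 3 * x ^ 2 - (k + 3) * y - 1/8 * (k + 1) * (2*k + 3)

/-- `h_k^n(j, Δ) = Σ_{m=0}^{n−1} f_k(j−m, Δ)`. -/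
def hC (k : ℂ) (n : ℕ) (j Δ : ℂ) : ℂ := ∑ m ∈ Finset.range n, fC k (j - m) Δ

/-- The left ideal of `A_k` by which one quotients to obtain the Verma module `V_{j,Δ}`:
it is generated by `G⁺`, `J − j·1` and `L − Δ·1`.  (The Verma module
`A_k ⊗_{A_k^≥} ℂ_{j,Δ}` is canonically the quotient of `A_k` by this left ideal.) -/
def vermaIdeal (k j Δ : ℂ) : Submodule (A k) (A k) :=
  Submodule.span (A k)
    {Gp k, J k - algebraMap ℂ (A k) j, L k - algebraMap ℂ (A k) Δ}

/-- The Verma module `V_{j,Δ} = A_k ⊗_{A_k^≥} ℂ_{j,Δ}`, realised as `A_k / A_k·(G⁺, J−j, L−Δ)`. -/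
abbrev Verma (k j Δ : ℂ) : Type := A k ⧸ vermaIdeal k j Δ

/-- The highest-weight vector `v = 1 ⊗ v` of the Verma module `V_{j,Δ}`. -/
def hwv (k j Δ : ℂ) : Verma k j Δ := Submodule.Quotient.mk (1 : A k)

/-- The factor module `P / N` associated to a pair of submodules `N ≤ P` of an
`A_k`-module. -/
abbrev factorModule (k : ℂ) {M : Type} [AddCommGroup M] [Module (A k) M]
    (N P : Submodule (A k) M) : Type :=
  P ⧸ N.comap P.subtype

/-- Finite-dimensionality over `ℂ` of an `A_k`-module (the `ℂ`-action being obtained by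
restricting the `A_k`-action along `algebraMap ℂ (A k)`). -/
def FinDimOverC (k : ℂ) (M : Type) [AddCommGroup M] [Module (A k) M] : Prop :=
  letI : Module ℂ M := Module.compHom M (algebraMap ℂ (A k))
  Module.Finite ℂ M

/-! ### The relations in `A_k` -/

lemma Gp_mul_Gm (k : ℂ) :
    Gp k * Gm k = Gm k * Gp k + (3 * J k ^ 2 - algebraMap ℂ (A k) (k + 3) * L k
      - algebraMap ℂ (A k) (1/8 * (k + 1) * (2*k + 3))) := by
  have h := RingQuot.mkAlgHom_rel ℂ (Rel.gpgm (k := k))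
  change mk k _ = mk k _ at h
  rw [← sub_eq_iff_eq_add']
  simp only [fF, map_sub, map_mul, map_pow, map_ofNat (mk k) 3, AlgHom.commutes] at h
  simp only [map_mul]
  exact h

lemma J_mul_Gm (k : ℂ) : J k * Gm k = Gm k * J k - Gm k := by
  have h := RingQuot.mkAlgHom_rel ℂ (Rel.jgm (k := k))
  change mk k _ = mk k _ at h
  rw [sub_eq_add_neg, ← sub_eq_iff_eq_add']
  simp only [map_sub, map_mul, map_neg] at h
  exact h

lemma L_mul_Gm (k : ℂ) : L k * Gm k = Gm k * L k := by
  have h := RingQuot.mkAlgHom_rel ℂ (Rel.lgm (k := k))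
  change mk k _ = mk k _ at h
  simp only [map_mul] at h
  exact h

lemma mk_surjective (k : ℂ) : Function.Surjective (mk k) :=
  RingQuot.mkAlgHom_surjective ℂ (Rel k)

lemma hC_succ (k : ℂ) (n : ℕ) (j Δ : ℂ) : hC k (n + 1) j Δ = hC k n j Δ + fC k (j - n) Δ := by
  simp [hC, Finset.sum_range_succ]

@[simp] lemma hC_zero (k j Δ : ℂ) : hC k 0 j Δ = 0 := by simp [hC]

/-! ### The action on finitely supported sequences -/

/-- The endomorphism of `ℕ →₀ ℂ` sending the `n`-th basis vector to `c n` times the `s n`-th. -/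
def weightedShift (c : ℕ → ℂ) (s : ℕ → ℕ) : Module.End ℂ (ℕ →₀ ℂ) :=
  Finsupp.linearCombination ℂ fun n => Finsupp.single (s n) (c n)

@[simp] lemma weightedShift_single (c : ℕ → ℂ) (s : ℕ → ℕ) (n : ℕ) :
    weightedShift c s (Finsupp.single n 1) = c n • Finsupp.single (s n) 1 := by
  rw [weightedShift, Finsupp.linearCombination_single, one_smul, Finsupp.smul_single_one]

/-- The images of the four generators in the sequence model of the Verma module. -/
def genAction (k j Δ : ℂ) : Fin 4 → Module.End ℂ (ℕ →₀ ℂ) :=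
  ![weightedShift (fun n => j - n) id, weightedShift (fun n => hC k n j Δ) (· - 1),
    weightedShift 1 (· + 1), Δ • 1]

lemma genAction_rel (k j Δ : ℂ) ⦃x y : F⦄ (h : Rel k x y) :
    FreeAlgebra.lift ℂ (genAction k j Δ) x = FreeAlgebra.lift ℂ (genAction k j Δ) y := by
  have h3 : (3 : F) = algebraMap ℂ F 3 := (map_ofNat (algebraMap ℂ F) 3).symm
  cases h <;> refine Finsupp.lhom_ext' fun n => LinearMap.ext_ring ?_ <;>
    simp only [jF, gpF, gmF, lF, fF, h3, pow_two, map_sub, map_mul, map_neg, map_one,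
      FreeAlgebra.lift_ι_apply, genAction, Algebra.algebraMap_eq_smul_one, LinearMap.comp_apply,
      Finsupp.lsingle_apply, LinearMap.sub_apply, LinearMap.neg_apply, Module.End.mul_apply,
      Module.End.one_apply, LinearMap.smul_apply, Matrix.cons_val, weightedShift_single, map_smul,
      Pi.one_apply, one_smul, id, Nat.add_sub_cancel]
  case lj | lgp => exact smul_comm ..
  case jgp =>
    rcases n with _ | n
    · simp
    · push_cast [Nat.add_sub_cancel]
      module
  case jgm =>
    push_cast
    module
  case gpgm =>
    rw [hC_succ, fC]
    rcases n with _ | n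
    · simp only [hC_zero]
      module
    · rw [Nat.add_sub_cancel]
      module

/-- The representation of `A_k` on `ℕ →₀ ℂ` modelling the Verma module. -/
def seqRep (k j Δ : ℂ) : A k →ₐ[ℂ] Module.End ℂ (ℕ →₀ ℂ) :=
  RingQuot.liftAlgHom ℂ ⟨FreeAlgebra.lift ℂ (genAction k j Δ), genAction_rel k j Δ⟩

lemma seqRep_mk (k j Δ : ℂ) (x : F) :
    seqRep k j Δ (mk k x) = FreeAlgebra.lift ℂ (genAction k j Δ) x :=
  RingQuot.liftAlgHom_mkAlgHom_apply ..

/-- Acting on the zeroth basis vector of the sequence model descends to the Verma module. -/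
def vermaToSeq (k j Δ : ℂ) : Verma k j Δ →ₗ[ℂ] (ℕ →₀ ℂ) :=
  ((vermaIdeal k j Δ).restrictScalars ℂ).liftQ
    ((LinearMap.applyₗ (Finsupp.single 0 1)).comp (seqRep k j Δ).toLinearMap) (by
      intro a ha
      change seqRep k j Δ a (Finsupp.single 0 1) = 0
      have ha' : a ∈ vermaIdeal k j Δ := ha
      induction ha' using Submodule.span_induction with
      | mem x hx =>
        rcases hx with rfl | rfl | rfl
        · simp [Gp, seqRep_mk, gpF, genAction]
        · simp [J, seqRep_mk, jF, genAction, Algebra.algebraMap_eq_smul_one]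
        · simp [L, seqRep_mk, lF, genAction, Algebra.algebraMap_eq_smul_one]
      | zero => simp
      | add x y _ _ hx hy => simp [hx (by assumption), hy (by assumption)]
      | smul a x _ hx => simp [hx (by assumption)])
    ∘ₗ (Submodule.Quotient.restrictScalarsEquiv ℂ (vermaIdeal k j Δ)).symm.toLinearMap

lemma vermaToSeq_mk (k j Δ : ℂ) (a : A k) :
    vermaToSeq k j Δ (Submodule.Quotient.mk a) = seqRep k j Δ a (Finsupp.single 0 1) := rfl

lemma vermaToSeq_Gm_pow (k j Δ : ℂ) (n : ℕ) :
    vermaToSeq k j Δ (Gm k ^ n • hwv k j Δ) = Finsupp.single n 1 := by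
  rw [hwv, ← Submodule.Quotient.mk_smul, vermaToSeq_mk, smul_eq_mul, mul_one]
  induction n with
  | zero => simp
  | succ n ih =>
    rw [pow_succ', map_mul, Module.End.mul_apply, ih]
    simp [Gm, seqRep_mk, gmF, genAction]

/-! ### Modules with a basis of weight vectors -/

section Modules

variable {k : ℂ} {M : Type} [AddCommGroup M] [Module (A k) M] [Module ℂ M]
  [IsScalarTower ℂ (A k) M]

lemma algebraMap_mul_smul (c : ℂ) (a : A k) (x : M) :
    (algebraMap ℂ (A k) c * a) • x = c • a • x := by
  rw [mul_smul, algebraMap_smul]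

lemma finDimOverC_iff : FinDimOverC k M ↔ Module.Finite ℂ M := by
  have h : (Module.compHom M (algebraMap ℂ (A k)) : Module ℂ M) = ‹Module ℂ M› :=
    Module.ext' _ _ fun c x => algebraMap_smul (A k) c x
  unfold FinDimOverC
  rw [h]

lemma smul_mem_of_generators (W : Submodule ℂ M) (hJ : ∀ x ∈ W, J k • x ∈ W)
    (hGp : ∀ x ∈ W, Gp k • x ∈ W) (hGm : ∀ x ∈ W, Gm k • x ∈ W) (hL : ∀ x ∈ W, L k • x ∈ W)
    (a : A k) : ∀ x ∈ W, a • x ∈ W := by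
  obtain ⟨a, rfl⟩ := mk_surjective k a
  induction a using FreeAlgebra.induction with
  | grade0 c =>
    intro x hx
    rw [AlgHom.commutes, algebraMap_smul]
    exact W.smul_mem c hx
  | grade1 i =>
    fin_cases i
    exacts [hJ, hGp, hGm, hL]
  | mul a b ha hb => exact fun x hx => by rw [map_mul, mul_smul]; exact ha _ (hb _ hx)
  | add a b ha hb =>
    intro x hx
    rw [map_add, add_smul]
    exact W.add_mem (ha _ hx) (hb _ hx)

lemma smul_mem_span_of_forall {s : Set M} {W : Submodule ℂ M} (a : A k) (h : ∀ x ∈ s, a • x ∈ W) :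
    ∀ x ∈ Submodule.span ℂ s, a • x ∈ W :=
  (Submodule.span_le (p := W.comap (Algebra.lsmul ℂ ℂ M a))).2 h

variable (k M) in
/-- A `ℂ`-basis on which the generators of `A_k` act as on the vectors `(G⁻)ⁿ v` of the Verma
module `V_{j,Δ}`. -/
structure WeightBasis (j Δ : ℂ) where
  basis : Module.Basis ℕ ℂ M
  J_smul : ∀ n, J k • basis n = (j - n) • basis n
  L_smul : ∀ n, L k • basis n = Δ • basis n
  Gm_smul : ∀ n, Gm k • basis n = basis (n + 1)
  Gp_smul : ∀ n, Gp k • basis n = hC k n j Δ • basis (n - 1)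

end Modules

section VermaBasis

variable (k j Δ : ℂ)

lemma Gp_smul_hwv : Gp k • hwv k j Δ = 0 := by
  rw [hwv, ← Submodule.Quotient.mk_smul, Submodule.Quotient.mk_eq_zero]
  exact Submodule.subset_span (Or.inl (mul_one _))

lemma J_smul_hwv : J k • hwv k j Δ = j • hwv k j Δ := by
  rw [hwv, ← Submodule.Quotient.mk_smul, ← Submodule.Quotient.mk_smul, Submodule.Quotient.eq]
  refine Submodule.subset_span (Or.inr (Or.inl ?_))
  simp [Algebra.algebraMap_eq_smul_one]

lemma L_smul_hwv : L k • hwv k j Δ = Δ • hwv k j Δ := by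
  rw [hwv, ← Submodule.Quotient.mk_smul, ← Submodule.Quotient.mk_smul, Submodule.Quotient.eq]
  refine Submodule.subset_span (Or.inr (Or.inr ?_))
  simp [Algebra.algebraMap_eq_smul_one]

lemma J_smul_Gm_pow (n : ℕ) :
    J k • Gm k ^ n • hwv k j Δ = (j - n) • Gm k ^ n • hwv k j Δ := by
  induction n with
  | zero => simpa using J_smul_hwv k j Δ
  | succ n ih =>
    rw [pow_succ', mul_smul, ← mul_smul (J k), J_mul_Gm, sub_smul, mul_smul, ih,
      smul_comm (Gm k) (j - n : ℂ)]
    rw [Nat.cast_succ, ← sub_sub, sub_smul (j - n : ℂ), one_smul]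

lemma L_smul_Gm_pow (n : ℕ) : L k • Gm k ^ n • hwv k j Δ = Δ • Gm k ^ n • hwv k j Δ := by
  induction n with
  | zero => simpa using L_smul_hwv k j Δ
  | succ n ih =>
    rw [pow_succ', mul_smul, ← mul_smul (L k), L_mul_Gm, mul_smul, ih, smul_comm]

lemma Gp_smul_Gm_pow (n : ℕ) :
    Gp k • Gm k ^ n • hwv k j Δ = hC k n j Δ • Gm k ^ (n - 1) • hwv k j Δ := by
  induction n with
  | zero => simpa using Gp_smul_hwv k j Δ
  | succ n ih =>
    have key : Gm k • hC k n j Δ • Gm k ^ (n - 1) • hwv k j Δ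
        = hC k n j Δ • Gm k ^ n • hwv k j Δ := by
      rcases n with _ | n
      · simp
      · rw [smul_comm, ← mul_smul, Nat.add_sub_cancel, ← pow_succ']
    have h3 : (3 : A k) = algebraMap ℂ (A k) 3 := (map_ofNat (algebraMap ℂ (A k)) 3).symm
    rw [pow_succ', mul_smul, ← mul_smul (Gp k), Gp_mul_Gm, add_smul, mul_smul, ih, key, hC_succ,
      add_smul, Nat.add_sub_cancel, sub_smul, sub_smul, h3, algebraMap_mul_smul, pow_two, mul_smul,
      J_smul_Gm_pow, smul_comm (J k), J_smul_Gm_pow, algebraMap_mul_smul, L_smul_Gm_pow,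
      algebraMap_smul, smul_smul, smul_smul, smul_smul, ← sub_smul, ← sub_smul]
    congr 2
    rw [fC]; ring

/-- The vectors `(G⁻)ⁿ v` form a basis of the Verma module. -/
def vermaWeightBasis : WeightBasis k (Verma k j Δ) j Δ :=
  let b : Module.Basis ℕ ℂ (Verma k j Δ) :=
    Module.Basis.mk (v := fun n => Gm k ^ n • hwv k j Δ)
      (by
        refine LinearIndependent.of_comp (vermaToSeq k j Δ) ?_
        convert (Finsupp.basisSingleOne (R := ℂ) (ι := ℕ)).linearIndependent
        ext1 n
        simp [vermaToSeq_Gm_pow])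
      (by
        rintro x -
        obtain ⟨a, rfl⟩ := Submodule.Quotient.mk_surjective _ x
        have h : (Submodule.Quotient.mk a : Verma k j Δ) = a • Gm k ^ 0 • hwv k j Δ := by
          rw [pow_zero, one_smul, hwv, ← Submodule.Quotient.mk_smul, smul_eq_mul, mul_one]
        have hmem (n : ℕ) : Gm k ^ n • hwv k j Δ ∈
          Submodule.span ℂ (Set.range fun n => Gm k ^ n • hwv k j Δ) :=
          Submodule.subset_span ⟨n, rfl⟩
        rw [h]
        refine smul_mem_of_generators _ ?_ ?_ ?_ ?_ a _ (hmem 0) <;>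
          refine smul_mem_span_of_forall _ ?_ <;> rintro _ ⟨n, rfl⟩
        · rw [J_smul_Gm_pow]; exact Submodule.smul_mem _ _ (hmem _)
        · rw [Gp_smul_Gm_pow]; exact Submodule.smul_mem _ _ (hmem _)
        · change Gm k • Gm k ^ n • hwv k j Δ ∈ _
          rw [← mul_smul, ← pow_succ']; exact hmem _
        · rw [L_smul_Gm_pow]; exact Submodule.smul_mem _ _ (hmem _))
  { basis := b
    J_smul := fun n => by simp only [b, Module.Basis.mk_apply, J_smul_Gm_pow]
    L_smul := fun n => by simp only [b, Module.Basis.mk_apply, L_smul_Gm_pow]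
    Gm_smul := fun n => by simp only [b, Module.Basis.mk_apply, ← mul_smul, ← pow_succ']
    Gp_smul := fun n => by simp only [b, Module.Basis.mk_apply, Gp_smul_Gm_pow] }

end VermaBasis

/-! ### Submodules -/

lemma mem_span_basis_image_Ici {M : Type*} [AddCommGroup M] [Module ℂ M]
    (b : Module.Basis ℕ ℂ M) (n : ℕ) (x : M) :
    x ∈ Submodule.span ℂ (b '' Set.Ici n) ↔ ∀ m < n, b.repr x m = 0 := by
  rw [Module.Basis.mem_span_image]
  constructor
  · intro h m hm
    by_contra hne
    exact absurd (h (Finsupp.mem_support_iff.2 hne)) (by simpa using hm)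
  · intro h m hm
    by_contra hlt
    exact Finsupp.mem_support_iff.1 hm (h m (by simpa using hlt))

namespace WeightBasis

variable {k j Δ : ℂ} {M : Type} [AddCommGroup M] [Module (A k) M] [Module ℂ M]
  [IsScalarTower ℂ (A k) M] (B : WeightBasis k M j Δ)

/-- The submodule spanned by the basis vectors of index at least `n`, where `h_k^n(j, Δ) = 0`. -/
def tail (n : {n : ℕ // hC k n j Δ = 0}) : Submodule (A k) M where
  toAddSubmonoid := (Submodule.span ℂ (B.basis '' Set.Ici (n : ℕ))).toAddSubmonoid
  smul_mem' a x hx := by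
    obtain ⟨n, hn⟩ := n
    have hmem (m : ℕ) (hm : n ≤ m) : B.basis m ∈ Submodule.span ℂ (B.basis '' Set.Ici n) :=
      Submodule.subset_span ⟨m, hm, rfl⟩
    refine smul_mem_of_generators (Submodule.span ℂ (B.basis '' Set.Ici n)) ?_ ?_ ?_ ?_ a x hx <;>
      refine smul_mem_span_of_forall _ ?_ <;> rintro _ ⟨m, hm, rfl⟩ <;>
      rw [Set.mem_Ici] at hm
    · rw [J_smul]; exact Submodule.smul_mem _ _ (hmem _ hm)
    · rw [Gp_smul]
      rcases hm.eq_or_lt with rfl | hlt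
      · simp [hn]
      · exact Submodule.smul_mem _ _ (hmem _ (by omega))
    · rw [Gm_smul]; exact hmem _ (by omega)
    · rw [L_smul]; exact Submodule.smul_mem _ _ (hmem _ hm)

lemma mem_tail {n : {n : ℕ // hC k n j Δ = 0}} {x : M} :
    x ∈ B.tail n ↔ ∀ m < (n : ℕ), B.basis.repr x m = 0 :=
  mem_span_basis_image_Ici B.basis n x

lemma basis_mem_tail {n : {n : ℕ // hC k n j Δ = 0}} {m : ℕ} :
    B.basis m ∈ B.tail n ↔ (n : ℕ) ≤ m := by
  rw [mem_tail]
  constructor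
  · intro h
    by_contra! hlt
    simpa using h m hlt
  · intro h i hi
    rw [Module.Basis.repr_self, Finsupp.single_eq_of_ne (by omega)]

lemma tail_le_tail {m n : {n : ℕ // hC k n j Δ = 0}} : B.tail m ≤ B.tail n ↔ n ≤ m := by
  constructor
  · exact fun h => B.basis_mem_tail.1 (h (B.basis_mem_tail.2 le_rfl))
  · exact fun h x hx => B.mem_tail.2 fun i hi => B.mem_tail.1 hx i (hi.trans_le h)

lemma tail_lt_tail {m n : {n : ℕ // hC k n j Δ = 0}} : B.tail m < B.tail n ↔ n < m := by
  simp only [lt_iff_le_not_ge, tail_le_tail]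

lemma tail_ne_bot (n : {n : ℕ // hC k n j Δ = 0}) : B.tail n ≠ ⊥ := fun h =>
  B.basis.ne_zero n <| (Submodule.mem_bot (A k)).1 (h ▸ B.basis_mem_tail.2 le_rfl)

lemma tail_zero : B.tail ⟨0, hC_zero k j Δ⟩ = ⊤ :=
  eq_top_iff.2 fun _ _ => B.mem_tail.2 fun _ hm => absurd hm (Nat.not_lt_zero _)

open Polynomial in
lemma aeval_J_smul_basis (p : ℂ[X]) (n : ℕ) :
    aeval (J k) p • B.basis n = p.eval (j - n) • B.basis n := by
  induction p using Polynomial.induction_on' with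
  | add p q hp hq => rw [map_add, add_smul, hp, hq, eval_add, add_smul]
  | monomial i c =>
    rw [aeval_monomial, algebraMap_mul_smul, eval_monomial, mul_smul]
    congr 1
    induction i with
    | zero => simp
    | succ i ih => rw [pow_succ, mul_smul, J_smul, smul_comm, ih, pow_succ', mul_smul]

lemma basis_mem_of_repr_ne_zero {S : Submodule (A k) M} {x : M} (hx : x ∈ S) {n : ℕ}
    (hn : B.basis.repr x n ≠ 0) : B.basis n ∈ S := by
  set s := (B.basis.repr x).support
  have hinj : Set.InjOn (fun n : ℕ => j - (n : ℂ)) s := fun a _ b _ h => by simpa using h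
  have hns : n ∈ s := Finsupp.mem_support_iff.2 hn
  set p := Lagrange.basis s (fun n : ℕ => j - (n : ℂ)) n
  have hp (m : ℕ) (hm : m ∈ s) (hmn : m ≠ n) : p.eval (j - m) = 0 :=
    Lagrange.eval_basis_of_ne (v := fun n : ℕ => j - (n : ℂ)) hmn.symm hm
  have key : Polynomial.aeval (J k) p • x = B.basis.repr x n • B.basis n := by
    conv_lhs => rw [← B.basis.linearCombination_repr x, Finsupp.linearCombination_apply,
      Finsupp.sum, Finset.smul_sum]
    rw [Finset.sum_eq_single_of_mem n hns]
    · rw [smul_comm, aeval_J_smul_basis, Lagrange.eval_basis_self hinj hns,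
        one_smul]
    · intro m hm hmn
      rw [smul_comm, aeval_J_smul_basis, hp m hm hmn, zero_smul, smul_zero]
  have h := S.smul_mem (Polynomial.aeval (J k) p) hx
  rw [key] at h
  have h' := (S.restrictScalars ℂ).smul_mem (B.basis.repr x n)⁻¹ h
  rwa [inv_smul_smul₀ hn] at h'

lemma exists_eq_tail {S : Submodule (A k) M} (hS : S ≠ ⊥) : ∃ n, S = B.tail n := by
  classical
  obtain ⟨x, hx, hx0⟩ := S.ne_bot_iff.1 hS
  have hex : ∃ n, B.basis n ∈ S := by
    obtain ⟨n, hn⟩ := DFunLike.ne_iff.1 ((map_ne_zero_iff _ B.basis.repr.injective).2 hx0)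
    exact ⟨n, B.basis_mem_of_repr_ne_zero hx hn⟩
  have hmem := Nat.find_spec hex
  have hmin : ∀ m, B.basis m ∈ S → Nat.find hex ≤ m := fun m hm => Nat.find_min' hex hm
  generalize Nat.find hex = n at hmem hmin
  have hroot : hC k n j Δ = 0 := by
    rcases n with _ | n
    · exact hC_zero k j Δ
    · by_contra hne
      have h := S.smul_mem (Gp k) hmem
      rw [Gp_smul] at h
      have h' := (S.restrictScalars ℂ).smul_mem (hC k (n + 1) j Δ)⁻¹ h
      rw [inv_smul_smul₀ hne] at h'
      exact absurd (hmin _ h') (by omega)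
  refine ⟨⟨n, hroot⟩, le_antisymm (fun y hy => B.mem_tail.2 fun m hm => ?_) ?_⟩
  · by_contra hne
    exact hm.not_ge (hmin m (B.basis_mem_of_repr_ne_zero hy hne))
  · suffices h : Submodule.span ℂ (B.basis '' Set.Ici n) ≤ S.restrictScalars ℂ from h
    rw [Submodule.span_le]
    rintro _ ⟨m, hm, rfl⟩
    induction m, hm using Nat.le_induction with
    | base => exact hmem
    | succ m _ ih => rw [← B.Gm_smul]; exact S.smul_mem (Gm k) ih

lemma tail_covBy_tail {m n : {n : ℕ // hC k n j Δ = 0}} (h : n ⋖ m) : B.tail m ⋖ B.tail n := by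
  refine ⟨B.tail_lt_tail.2 h.lt, fun S hmS hSn => ?_⟩
  obtain ⟨i, rfl⟩ := B.exists_eq_tail (ne_bot_of_gt hmS)
  exact h.2 (B.tail_lt_tail.1 hSn) (B.tail_lt_tail.1 hmS)

lemma bot_covBy_tail {n : {n : ℕ // hC k n j Δ = 0}} (h : IsMax n) : ⊥ ⋖ B.tail n := by
  refine ⟨bot_lt_iff_ne_bot.2 (B.tail_ne_bot n), fun S hS hSn => ?_⟩
  obtain ⟨i, rfl⟩ := B.exists_eq_tail hS.ne'
  exact h.not_lt (B.tail_lt_tail.1 hSn)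

lemma finDimOverC_factorModule (m : {n : ℕ // hC k n j Δ = 0}) (P : Submodule (A k) M) :
    FinDimOverC k (factorModule k (B.tail m) P) := by
  rw [finDimOverC_iff]
  let N := (B.tail m).comap P.subtype
  let g : P →ₗ[ℂ] (Fin m → ℂ) :=
    LinearMap.pi fun i => (B.basis.coord i).comp (P.subtype.restrictScalars ℂ)
  have hker : LinearMap.ker g = N.restrictScalars ℂ := by
    ext x
    simp only [LinearMap.mem_ker, funext_iff, Fin.forall_iff]
    exact B.mem_tail.symm
  let e := Submodule.Quotient.restrictScalarsEquiv ℂ N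
  have : Module.Finite ℂ (P ⧸ N.restrictScalars ℂ) :=
    Module.Finite.of_injective ((N.restrictScalars ℂ).liftQ g hker.ge)
      (LinearMap.ker_eq_bot.1 (Submodule.ker_liftQ_eq_bot _ _ _ hker.le))
  exact Module.Finite.equiv e

lemma not_finDimOverC_factorModule_bot (n : {n : ℕ // hC k n j Δ = 0}) :
    ¬ FinDimOverC k (factorModule k ⊥ (B.tail n)) := by
  rw [finDimOverC_iff]
  intro hfin
  let π := ((⊥ : Submodule (A k) M).comap (B.tail n).subtype).mkQ.restrictScalars ℂ
  have hπ : LinearMap.ker π = ⊥ := by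
    rw [LinearMap.ker_restrictScalars, Submodule.ker_mkQ, Submodule.comap_bot,
      Submodule.ker_subtype, Submodule.restrictScalars_bot]
  let v : ℕ → B.tail n := fun i => ⟨B.basis (n + i), B.basis_mem_tail.2 (Nat.le_add_right _ _)⟩
  have hv : LinearIndependent ℂ v :=
    LinearIndependent.of_comp ((B.tail n).subtype.restrictScalars ℂ)
      (B.basis.linearIndependent.comp (fun i => (n : ℕ) + i) (add_right_injective _))
  have := (hv.map' π hπ).finite
  exact not_finite ℕ

end WeightBasis

/-! ### The composition series -/

lemma hC_eq_eval (k j Δ : ℂ) (n : ℕ) :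
    hC k n j Δ = (n : ℂ) ^ 3 - (3/2 + 3 * j) * (n : ℂ) ^ 2
      + (3 * j ^ 2 + 3 * j + 1/2 - (k + 3) * Δ - 1/8 * (k + 1) * (2*k + 3)) * n := by
  induction n with
  | zero => simp
  | succ n ih => rw [hC_succ, ih, fC]; push_cast; ring

lemma exists_finset_hC_roots (k j Δ : ℂ) :
    ∃ s : Finset ℕ, s.card ≤ 3 ∧ ∀ n, n ∈ s ↔ hC k n j Δ = 0 := by
  let P : Cubic ℂ := ⟨1, -(3/2 + 3 * j),
    3 * j ^ 2 + 3 * j + 1/2 - (k + 3) * Δ - 1/8 * (k + 1) * (2*k + 3), 0⟩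
  have hP : P.toPoly ≠ 0 := Cubic.ne_zero_of_a_ne_zero one_ne_zero
  refine ⟨P.toPoly.roots.toFinset.preimage Nat.cast Nat.cast_injective.injOn, ?_, fun n => ?_⟩
  · calc _ ≤ P.toPoly.roots.toFinset.card :=
          Finset.card_le_card_of_injOn Nat.cast (fun n hn => by simpa using hn)
            Nat.cast_injective.injOn
      _ ≤ Multiset.card P.toPoly.roots := Multiset.toFinset_card_le _
      _ ≤ P.toPoly.natDegree := P.toPoly.card_roots'
      _ = 3 := Cubic.natDegree_of_a_ne_zero one_ne_zero
  · rw [Finset.mem_preimage, Multiset.mem_toFinset, Polynomial.mem_roots hP, hC_eq_eval,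
      Polynomial.IsRoot.def]
    simp [Cubic.toPoly, P, sub_eq_add_neg]
    ring_nf

lemma exists_orderIso_hC_roots (k j Δ : ℂ) :
    ∃ c ≤ 2, Nonempty (Fin (c + 1) ≃o {n : ℕ // hC k n j Δ = 0}) := by
  obtain ⟨s, hs, hmem⟩ := exists_finset_hC_roots k j Δ
  obtain ⟨c, hc⟩ : ∃ c, s.card = c + 1 :=
    Nat.exists_eq_succ_of_ne_zero (Finset.card_ne_zero_of_mem ((hmem 0).2 (hC_zero k j Δ)))
  exact ⟨c, by omega,
    ⟨(s.orderIsoOfFin hc).trans (OrderIso.setCongr (s : Set ℕ) _ (Set.ext hmem))⟩⟩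

/-- The composition series of tails attached to an enumeration of the roots of `n ↦ h_k^n`. -/
def WeightBasis.compositionSeries {k j Δ : ℂ} {M : Type} [AddCommGroup M] [Module (A k) M]
    [Module ℂ M] [IsScalarTower ℂ (A k) M] (B : WeightBasis k M j Δ) {c : ℕ}
    (e : Fin (c + 1) ≃o {n : ℕ // hC k n j Δ = 0}) : CompositionSeries (Submodule (A k) M) where
  length := c + 1
  toFun := Fin.cons ⊥ fun i => B.tail (e i.rev)
  step i := by
    refine Fin.cases ?_ (fun i => ?_) i
    · rw [Fin.castSucc_zero, Fin.cons_zero, Fin.cons_succ, Fin.rev_zero]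
      exact B.bot_covBy_tail fun n _ => (e.symm_apply_le).1 (Fin.le_last _)
    · rw [Fin.castSucc_succ, Fin.cons_succ, Fin.cons_succ, Fin.rev_castSucc, Fin.rev_succ]
      exact B.tail_covBy_tail ((apply_covBy_apply_iff e).2 (by simp [Fin.covBy_iff]))

/-- every Verma module `V_{j,Δ}` over `A_k` has finite length with at most
three composition factors, exactly one of which is infinite-dimensional over `ℂ`. -/
theorem verma_composition_series (k j Δ : ℂ) :
    ∃ s : CompositionSeries (Submodule (A k) (Verma k j Δ)),
      s.head = ⊥ ∧ s.last = ⊤ ∧ s.length ≤ 3 ∧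
      (∃! i : Fin s.length,
        ¬ FinDimOverC k (factorModule k (s i.castSucc) (s i.succ))) := by
  obtain ⟨c, hc, ⟨e⟩⟩ := exists_orderIso_hC_roots k j Δ
  let B := vermaWeightBasis k j Δ
  refine ⟨B.compositionSeries e, rfl, ?_, Nat.succ_le_succ hc, (0 : Fin (c + 1)),
    B.not_finDimOverC_factorModule_bot _, ?_⟩
  · change B.tail (e (Fin.last c).rev) = ⊤
    rw [Fin.rev_last, ← B.tail_zero]
    congr 1
    exact le_antisymm ((e.le_symm_apply).1 (Fin.zero_le _)) (Nat.zero_le _)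
  · refine Fin.cases (fun _ => rfl) (fun i h => ?_)
    exact absurd (B.finDimOverC_factorModule _ _) h

end BP
end
end

section
/- The centraliser in A_k of the set {J, L} (equivalently, of the subalgebra ℂ[J, L]) is exactly the subalgebra of A_k generated by J, L and G⁺G⁻. This centraliser C_k is commutative, and it is a polynomial algebra on the three generators J, L, G⁺G⁻ (i.e. the monomials J^a L^b (G⁺G⁻)^c, a, b, c ∈ ℕ, form a ℂ-basis of C_k); equivalently, C_k equals the subalgebra generated by J, L and Ω, where Ω = G⁺G⁻ + G⁻G⁺ + 2J³ + J − 2J((k+3)L + (1/8)(k+1)(2k+3)·1). -/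
noncomputable section

namespace BP

/-- The central element `Ω = G⁺G⁻ + G⁻G⁺ + 2J³ + J − 2J((k+3)L + (1/8)(k+1)(2k+3)·1)`. -/
def Omega (k : ℂ) : A k :=
  Gp k * Gm k + Gm k * Gp k + 2 * J k ^ 3 + J k
    - 2 * J k * (algebraMap ℂ (A k) (k + 3) * L k
        + algebraMap ℂ (A k) (1/8 * (k + 1) * (2*k + 3)))

lemma L_mul_J (k : ℂ) : L k * J k = J k * L k := by
  have h := RingQuot.mkAlgHom_rel ℂ (Rel.lj (k := k))
  rw [map_mul, map_mul] at h
  exact h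

lemma L_mul_Gp (k : ℂ) : L k * Gp k = Gp k * L k := by
  have h := RingQuot.mkAlgHom_rel ℂ (Rel.lgp (k := k))
  rw [map_mul, map_mul] at h
  exact h

lemma J_mul_Gp (k : ℂ) : J k * Gp k = Gp k * J k + Gp k := by
  have h : mk k (jF * gpF - gpF * jF) = mk k gpF := RingQuot.mkAlgHom_rel ℂ Rel.jgp
  rw [map_sub, map_mul, map_mul] at h
  exact sub_eq_iff_eq_add'.mp h

/-- The element `f_k(J, L)` of `A_k`. -/
def fA (k : ℂ) : A k :=
  3 * J k ^ 2 - algebraMap ℂ (A k) (k + 3) * L k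
    - algebraMap ℂ (A k) (1/8 * (k + 1) * (2*k + 3))

lemma Gp_mul_Gm_s5 (k : ℂ) : Gp k * Gm k = Gm k * Gp k + fA k := by
  have h : mk k (gpF * gmF - gmF * gpF) = mk k (fF k) := RingQuot.mkAlgHom_rel ℂ Rel.gpgm
  have hf : mk k (fF k) = fA k := by
    simp only [fF, fA, map_sub, map_mul, map_pow, AlgHom.commutes, map_ofNat]
    rfl
  rw [map_sub, map_mul, map_mul, hf] at h
  exact sub_eq_iff_eq_add'.mp h

lemma commute_J_Gp_mul_Gm (k : ℂ) : Commute (J k) (Gp k * Gm k) := by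
  have h₁ := J_mul_Gp k
  have h₂ := J_mul_Gm k
  calc J k * (Gp k * Gm k) = (J k * Gp k) * Gm k := by noncomm_ring
    _ = Gp k * (J k * Gm k) + Gp k * Gm k := by rw [h₁]; noncomm_ring
    _ = Gp k * Gm k * J k := by rw [h₂]; noncomm_ring

lemma commute_L_Gp_mul_Gm (k : ℂ) : Commute (L k) (Gp k * Gm k) :=
  Commute.mul_right (L_mul_Gp k) (L_mul_Gm k)

/-- The subalgebra of `A_k` generated by `J`, `L` and `G⁺G⁻`. -/
abbrev weightZero (k : ℂ) : Subalgebra ℂ (A k) := Algebra.adjoin ℂ {J k, L k, Gp k * Gm k}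

lemma J_mem_weightZero (k : ℂ) : J k ∈ weightZero k := Algebra.subset_adjoin (by simp)

lemma L_mem_weightZero (k : ℂ) : L k ∈ weightZero k := Algebra.subset_adjoin (by simp)

lemma Gp_mul_Gm_mem_weightZero (k : ℂ) : Gp k * Gm k ∈ weightZero k :=
  Algebra.subset_adjoin (by simp)

lemma fA_mem (k : ℂ) {S : Subalgebra ℂ (A k)} (hJ : J k ∈ S) (hL : L k ∈ S) : fA k ∈ S :=
  S.sub_mem (S.sub_mem (S.mul_mem (ofNat_mem S 3) (S.pow_mem hJ 2))
    (S.mul_mem (S.algebraMap_mem _) hL)) (S.algebraMap_mem _)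

lemma Gm_mul_Gp_mem_weightZero (k : ℂ) : Gm k * Gp k ∈ weightZero k := by
  rw [eq_sub_of_add_eq (Gp_mul_Gm_s5 k).symm]
  exact sub_mem (Gp_mul_Gm_mem_weightZero k) (fA_mem k (J_mem_weightZero k) (L_mem_weightZero k))

/-- If `g` moves past the generators `s` into `S`, then it moves past all of `adjoin s`. -/
lemma exists_mul_eq_of_adjoin {R B : Type*} [CommRing R] [Ring B] [Algebra R B] {s : Set B}
    {S : Subalgebra R B} {g : B} (h : ∀ x ∈ s, ∃ c ∈ S, g * x = c * g) {x : B}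
    (hx : x ∈ Algebra.adjoin R s) : ∃ c ∈ S, g * x = c * g := by
  induction hx using Algebra.adjoin_induction with
  | mem x hx => exact h x hx
  | algebraMap r => exact ⟨_, S.algebraMap_mem r, (Algebra.commutes r g).symm⟩
  | add x y _ _ hx hy =>
    obtain ⟨c, hc, hc'⟩ := hx
    obtain ⟨d, hd, hd'⟩ := hy
    exact ⟨c + d, S.add_mem hc hd, by rw [mul_add, add_mul, hc', hd']⟩
  | mul x y _ _ hx hy =>
    obtain ⟨c, hc, hc'⟩ := hx
    obtain ⟨d, hd, hd'⟩ := hy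
    exact ⟨c * d, S.mul_mem hc hd, by rw [← mul_assoc, hc', mul_assoc, hd', mul_assoc]⟩

lemma Gp_mul_J (k : ℂ) : Gp k * J k = (J k - 1) * Gp k := by
  rw [sub_mul, J_mul_Gp, one_mul, add_sub_cancel_right]

lemma Gm_mul_J (k : ℂ) : Gm k * J k = (J k + 1) * Gm k := by
  rw [add_mul, J_mul_Gm, one_mul, sub_add_cancel]

lemma exists_Gm_mul (k : ℂ) {x : A k} (hx : x ∈ weightZero k) :
    ∃ c ∈ weightZero k, Gm k * x = c * Gm k := by
  refine exists_mul_eq_of_adjoin ?_ hx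
  rintro x (rfl | rfl | rfl)
  · exact ⟨_, add_mem (J_mem_weightZero k) (one_mem _), Gm_mul_J k⟩
  · exact ⟨_, L_mem_weightZero k, (L_mul_Gm k).symm⟩
  · exact ⟨_, Gm_mul_Gp_mem_weightZero k, (mul_assoc _ _ _).symm⟩

lemma exists_Gp_mul (k : ℂ) {x : A k} (hx : x ∈ weightZero k) :
    ∃ c ∈ weightZero k, Gp k * x = c * Gp k := by
  have hJL : ∀ x ∈ ({J k, L k} : Set (A k)), ∃ c ∈ weightZero k, Gp k * x = c * Gp k := by
    rintro x (rfl | rfl)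
    · exact ⟨_, sub_mem (J_mem_weightZero k) (one_mem _), Gp_mul_J k⟩
    · exact ⟨_, L_mem_weightZero k, (L_mul_Gp k).symm⟩
  refine exists_mul_eq_of_adjoin ?_ hx
  rintro x (rfl | rfl | rfl)
  · exact hJL _ (by simp)
  · exact hJL _ (by simp)
  · obtain ⟨c, hc, hc'⟩ := exists_mul_eq_of_adjoin hJL
      (fA_mem k (Algebra.subset_adjoin (by simp)) (Algebra.subset_adjoin (by simp)))
    refine ⟨Gp k * Gm k + c, add_mem (Gp_mul_Gm_mem_weightZero k) hc, ?_⟩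
    rw [add_mul, ← hc', mul_assoc, ← mul_add, ← Gp_mul_Gm_s5]

/-- The products `c (G⁺)ⁿ` and `c (G⁻)ⁿ` with `c` in `weightZero`. -/
def weightVectors (k : ℂ) : Set (A k) :=
  {x | ∃ c ∈ weightZero k, ∃ n : ℕ, x = c * Gp k ^ n ∨ x = c * Gm k ^ n}

lemma mul_mem_weightVectors (k : ℂ) (i : Fin 4) {x : A k} (hx : x ∈ weightVectors k) :
    mk k (FreeAlgebra.ι ℂ i) * x ∈ weightVectors k := by
  obtain ⟨c, hc, n, hx⟩ := hx
  fin_cases i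
  · change J k * x ∈ _
    refine ⟨J k * c, mul_mem (J_mem_weightZero k) hc, n, ?_⟩
    rcases hx with rfl | rfl
    · exact .inl (mul_assoc _ _ _).symm
    · exact .inr (mul_assoc _ _ _).symm
  · change Gp k * x ∈ _
    obtain ⟨d, hd, hd'⟩ := exists_Gp_mul k hc
    rcases hx with rfl | rfl
    · exact ⟨d, hd, n + 1, .inl (by rw [← mul_assoc, hd', mul_assoc, pow_succ'])⟩
    · cases n with
      | zero => exact ⟨d, hd, 1, .inl (by rw [pow_zero, mul_one, pow_one, hd'])⟩
      | succ n =>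
        refine ⟨d * (Gp k * Gm k), mul_mem hd (Gp_mul_Gm_mem_weightZero k), n, .inr ?_⟩
        rw [← mul_assoc, hd', pow_succ']
        simp only [mul_assoc]
  · change Gm k * x ∈ _
    obtain ⟨d, hd, hd'⟩ := exists_Gm_mul k hc
    rcases hx with rfl | rfl
    · cases n with
      | zero => exact ⟨d, hd, 1, .inr (by rw [pow_zero, mul_one, pow_one, hd'])⟩
      | succ n =>
        refine ⟨d * (Gm k * Gp k), mul_mem hd (Gm_mul_Gp_mem_weightZero k), n, .inl ?_⟩
        rw [← mul_assoc, hd', pow_succ']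
        simp only [mul_assoc]
    · exact ⟨d, hd, n + 1, .inr (by rw [← mul_assoc, hd', mul_assoc, pow_succ'])⟩
  · change L k * x ∈ _
    refine ⟨L k * c, mul_mem (L_mem_weightZero k) hc, n, ?_⟩
    rcases hx with rfl | rfl
    · exact .inl (mul_assoc _ _ _).symm
    · exact .inr (mul_assoc _ _ _).symm

lemma span_weightVectors (k : ℂ) : Submodule.span ℂ (weightVectors k) = ⊤ := by
  have key : ∀ a : F, ∀ y ∈ Submodule.span ℂ (weightVectors k),
      mk k a * y ∈ Submodule.span ℂ (weightVectors k) := by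
    intro a
    induction a using FreeAlgebra.induction with
    | grade0 r =>
      intro y hy
      rw [AlgHom.commutes, ← Algebra.smul_def]
      exact Submodule.smul_mem _ r hy
    | grade1 i =>
      intro y hy
      induction hy using Submodule.span_induction with
      | mem y hy => exact Submodule.subset_span (mul_mem_weightVectors k i hy)
      | zero => simp
      | add y z _ _ hy hz => rw [mul_add]; exact add_mem hy hz
      | smul r y _ hy => rw [mul_smul_comm]; exact Submodule.smul_mem _ r hy
    | mul a b ha hb =>
      intro y hy
      rw [map_mul, mul_assoc]
      exact ha _ (hb _ hy)
    | add a b ha hb =>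
      intro y hy
      rw [map_add, add_mul]
      exact add_mem (ha _ hy) (hb _ hy)
  refine eq_top_iff.mpr fun x _ => ?_
  obtain ⟨a, rfl⟩ : ∃ a, mk k a = x := RingQuot.mkAlgHom_surjective ℂ (Rel k) x
  rw [← mul_one (mk k a)]
  exact key a 1 (Submodule.subset_span ⟨1, one_mem _, 0, .inl (by simp)⟩)

/-- The derivation `x ↦ [J, x]` of `A_k`. -/
def adJ (k : ℂ) : Module.End ℂ (A k) := LinearMap.mulLeft ℂ (J k) - LinearMap.mulRight ℂ (J k)

lemma adJ_apply (k : ℂ) (x : A k) : adJ k x = J k * x - x * J k := rfl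

lemma adJ_mul (k : ℂ) (x y : A k) : adJ k (x * y) = adJ k x * y + x * adJ k y := by
  simp only [adJ_apply]
  noncomm_ring

lemma adJ_pow (k : ℂ) {g : A k} {μ : ℂ} (h : adJ k g = μ • g) (n : ℕ) :
    adJ k (g ^ n) = (n * μ) • g ^ n := by
  induction n with
  | zero => simp [adJ_apply]
  | succ n ih =>
    rw [pow_succ, adJ_mul, ih, h, smul_mul_assoc, mul_smul_comm, ← add_smul]
    push_cast
    ring_nf

lemma weightZero_comm (k : ℂ) {x y : A k} (hx : x ∈ weightZero k) (hy : y ∈ weightZero k) :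
    x * y = y * x := by
  refine Algebra.commute_of_mem_adjoin_of_forall_mem_commute hy fun b hb => ?_
  refine (Algebra.commute_of_mem_adjoin_of_forall_mem_commute hx fun a ha => ?_).symm
  have h₁ := commute_J_Gp_mul_Gm k
  have h₂ := commute_L_Gp_mul_Gm k
  have h₃ : Commute (L k) (J k) := L_mul_J k
  rcases ha with rfl | rfl | rfl <;> rcases hb with rfl | rfl | rfl <;>
    first | exact Commute.refl _ | assumption | (apply Commute.symm; assumption)

lemma adJ_of_mem_weightZero (k : ℂ) {c : A k} (hc : c ∈ weightZero k) : adJ k c = 0 := by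
  rw [adJ_apply, weightZero_comm k (J_mem_weightZero k) hc, sub_self]

lemma weightVectors_subset (k : ℂ) : weightVectors k ⊆
    (Subalgebra.toSubmodule (weightZero k) ⊔ ⨆ μ ≠ 0, (adJ k).eigenspace μ :
      Submodule ℂ (A k)) := by
  have key : ∀ c ∈ weightZero k, ∀ (g : A k) (μ : ℂ), μ ≠ 0 → adJ k g = μ • g → ∀ n : ℕ,
      c * g ^ n ∈ (Subalgebra.toSubmodule (weightZero k) ⊔ ⨆ μ ≠ 0, (adJ k).eigenspace μ :
      Submodule ℂ (A k)) := by
    intro c hc g μ hμ hg n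
    rcases Nat.eq_zero_or_pos n with rfl | hn
    · exact Submodule.mem_sup_left (by simpa using hc)
    · refine Submodule.mem_sup_right (Submodule.mem_iSup_of_mem (n * μ)
        (Submodule.mem_iSup_of_mem (mul_ne_zero (Nat.cast_ne_zero.mpr hn.ne') hμ) ?_))
      rw [Module.End.mem_eigenspace_iff, adJ_mul, adJ_of_mem_weightZero k hc, adJ_pow k hg,
        zero_mul, zero_add, mul_smul_comm]
  rintro x ⟨c, hc, n, rfl | rfl⟩
  · exact key c hc _ 1 one_ne_zero (by rw [adJ_apply, J_mul_Gp, one_smul]; abel) n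
  · exact key c hc _ (-1) (neg_ne_zero.mpr one_ne_zero)
      (by rw [adJ_apply, J_mul_Gm, neg_smul, one_smul]; abel) n

lemma mem_weightZero_of_commute (k : ℂ) {x : A k} (hx : J k * x = x * J k) : x ∈ weightZero k := by
  have hx' : x ∈ Subalgebra.toSubmodule (weightZero k) ⊔ ⨆ μ ≠ 0, (adJ k).eigenspace μ :=
    Submodule.span_le.mpr (weightVectors_subset k) (span_weightVectors k ▸ Submodule.mem_top)
  obtain ⟨c, hc, y, hy, rfl⟩ := Submodule.mem_sup.mp hx'
  have h0 : y ∈ (adJ k).eigenspace 0 := by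
    have h : adJ k (c + y) = 0 := by rw [adJ_apply, hx, sub_self]
    rw [map_add, adJ_of_mem_weightZero k hc, zero_add] at h
    rw [Module.End.mem_eigenspace_iff, h, zero_smul]
  have := (Module.End.eigenspaces_iSupIndep (adJ k) 0).le_bot ⟨h0, hy⟩
  rw [(Submodule.mem_bot ℂ).mp this, add_zero]
  exact hc

lemma centralizer_eq_weightZero (k : ℂ) :
    Subalgebra.centralizer ℂ ({J k, L k} : Set (A k)) = weightZero k := by
  refine le_antisymm (fun x hx => mem_weightZero_of_commute k (hx _ (by simp))) fun x hx => ?_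
  rintro y (rfl | rfl)
  · exact weightZero_comm k (J_mem_weightZero k) hx
  · exact weightZero_comm k (L_mem_weightZero k) hx

/-- The monomial `J^a L^b (G⁺G⁻)^c`. -/
abbrev mono (k : ℂ) (q : ℕ × ℕ × ℕ) : A k :=
  J k ^ q.1 * L k ^ q.2.1 * (Gp k * Gm k) ^ q.2.2

lemma mono_mem_weightZero (k : ℂ) (q : ℕ × ℕ × ℕ) : mono k q ∈ weightZero k :=
  mul_mem (mul_mem (pow_mem (J_mem_weightZero k) _) (pow_mem (L_mem_weightZero k) _))
    (pow_mem (Gp_mul_Gm_mem_weightZero k) _)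

lemma span_mono (k : ℂ) :
    Submodule.span ℂ (Set.range (mono k)) = Subalgebra.toSubmodule (weightZero k) := by
  refine le_antisymm (Submodule.span_le.mpr (Set.range_subset_iff.mpr (mono_mem_weightZero k)))
    fun x hx => ?_
  have hgen : ∀ g ∈ ({J k, L k, Gp k * Gm k} : Set (A k)), ∀ q, ∃ q', g * mono k q = mono k q' := by
    rintro g (rfl | rfl | rfl) ⟨a, b, c⟩
    · exact ⟨(a + 1, b, c), by simp only [mono, pow_succ', mul_assoc]⟩
    · refine ⟨(a, b + 1, c), ?_⟩
      have h : L k * J k ^ a = J k ^ a * L k := Commute.pow_right (L_mul_J k) a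
      simp only [mono, ← mul_assoc, h, pow_succ']
    · refine ⟨(a, b, c + 1), ?_⟩
      rw [weightZero_comm k (Gp_mul_Gm_mem_weightZero k) (mono_mem_weightZero k _)]
      simp only [mono, pow_succ, mul_assoc]
  have key : ∀ y ∈ Submodule.span ℂ (Set.range (mono k)),
      x * y ∈ Submodule.span ℂ (Set.range (mono k)) := by
    induction (show x ∈ weightZero k from hx) using Algebra.adjoin_induction with
    | mem g hg =>
      intro y hy
      induction hy using Submodule.span_induction with
      | mem y hy =>
        obtain ⟨q, rfl⟩ := hy
        obtain ⟨q', h⟩ := hgen g hg q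
        exact Submodule.subset_span ⟨q', h.symm⟩
      | zero => simp
      | add y z _ _ hy hz => rw [mul_add]; exact add_mem hy hz
      | smul r y _ hy => rw [mul_smul_comm]; exact Submodule.smul_mem _ r hy
    | algebraMap r =>
      intro y hy
      rw [← Algebra.smul_def]
      exact Submodule.smul_mem _ r hy
    | add a b ha' hb' ha hb =>
      intro y hy
      rw [add_mul]
      exact add_mem (ha ha' y hy) (hb hb' y hy)
    | mul a b ha' hb' ha hb =>
      intro y hy
      rw [mul_assoc]
      exact ha ha' _ (hb hb' _ hy)
  simpa using key 1 (Submodule.subset_span ⟨(0, 0, 0), by simp [mono]⟩)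

lemma adjoin_Omega (k : ℂ) :
    weightZero k = Algebra.adjoin ℂ ({J k, L k, Omega k} : Set (A k)) := by
  have hΩ : Omega k = (2 : ℂ) • (Gp k * Gm k) + (2 * J k ^ 3 + J k
      - 2 * J k * (algebraMap ℂ (A k) (k + 3) * L k
        + algebraMap ℂ (A k) (1/8 * (k + 1) * (2*k + 3))) - fA k) := by
    rw [Omega, eq_sub_of_add_eq (Gp_mul_Gm_s5 k).symm, two_smul]
    abel
  have hmem : ∀ S : Subalgebra ℂ (A k), J k ∈ S → L k ∈ S → (2 * J k ^ 3 + J k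
      - 2 * J k * (algebraMap ℂ (A k) (k + 3) * L k
        + algebraMap ℂ (A k) (1/8 * (k + 1) * (2*k + 3))) - fA k) ∈ S := by
    intro S hJ hL
    have h2 : (2 : A k) ∈ S := ofNat_mem S 2
    exact sub_mem (sub_mem (add_mem (mul_mem h2 (pow_mem hJ 3)) hJ) (mul_mem (mul_mem h2 hJ)
      (add_mem (mul_mem (S.algebraMap_mem _) hL) (S.algebraMap_mem _)))) (fA_mem k hJ hL)
  refine le_antisymm (Algebra.adjoin_le ?_) (Algebra.adjoin_le ?_)
  · have hJ : J k ∈ Algebra.adjoin ℂ {J k, L k, Omega k} := Algebra.subset_adjoin (by simp)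
    have hL : L k ∈ Algebra.adjoin ℂ {J k, L k, Omega k} := Algebra.subset_adjoin (by simp)
    rintro x (rfl | rfl | rfl)
    · exact hJ
    · exact hL
    · have hU : Gp k * Gm k = (2⁻¹ : ℂ) • (Omega k - (2 * J k ^ 3 + J k
          - 2 * J k * (algebraMap ℂ (A k) (k + 3) * L k
            + algebraMap ℂ (A k) (1/8 * (k + 1) * (2*k + 3))) - fA k)) := by
        rw [hΩ, add_sub_cancel_right, inv_smul_smul₀ two_ne_zero]
      rw [hU]
      exact Subalgebra.smul_mem _ (sub_mem (Algebra.subset_adjoin (by simp)) (hmem _ hJ hL)) _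
  · rintro x (rfl | rfl | rfl)
    · exact J_mem_weightZero k
    · exact L_mem_weightZero k
    · rw [hΩ]
      exact add_mem (Subalgebra.smul_mem _ (Gp_mul_Gm_mem_weightZero k) _)
        (hmem _ (J_mem_weightZero k) (L_mem_weightZero k))

open MvPolynomial in
/-- The polynomial `f_k(x, y)`. -/
def fPoly (k : ℂ) (x y : MvPolynomial (Fin 3) ℂ) : MvPolynomial (Fin 3) ℂ :=
  3 * x ^ 2 - C (k + 3) * y - C (1/8 * (k + 1) * (2*k + 3))

lemma map_fPoly (k : ℂ) (σ : MvPolynomial (Fin 3) ℂ →ₐ[ℂ] MvPolynomial (Fin 3) ℂ)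
    (x y : MvPolynomial (Fin 3) ℂ) : σ (fPoly k x y) = fPoly k (σ x) (σ y) := by
  simp only [fPoly, ← MvPolynomial.algebraMap_eq, map_sub, map_mul σ, map_pow, AlgHom.commutes,
    map_ofNat]

open MvPolynomial in
/-- The automorphism of `ℂ[j, l, u]` by which `G⁺` acts. -/
def shiftUp (k : ℂ) : MvPolynomial (Fin 3) ℂ →ₐ[ℂ] MvPolynomial (Fin 3) ℂ :=
  aeval ![X 0 - 1, X 1, X 2 + fPoly k (X 0 - 1) (X 1)]

open MvPolynomial in
/-- The inverse of `shiftUp`. -/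
def shiftDown (k : ℂ) : MvPolynomial (Fin 3) ℂ →ₐ[ℂ] MvPolynomial (Fin 3) ℂ :=
  aeval ![X 0 + 1, X 1, X 2 - fPoly k (X 0) (X 1)]

section

open MvPolynomial

lemma shiftUp_X0 (k : ℂ) : shiftUp k (X 0) = X 0 - 1 := by simp [shiftUp]

lemma shiftUp_X1 (k : ℂ) : shiftUp k (X 1) = X 1 := by simp [shiftUp]

lemma shiftUp_X2 (k : ℂ) : shiftUp k (X 2) = X 2 + fPoly k (X 0 - 1) (X 1) := by simp [shiftUp]

lemma shiftDown_X0 (k : ℂ) : shiftDown k (X 0) = X 0 + 1 := by simp [shiftDown]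

lemma shiftDown_X1 (k : ℂ) : shiftDown k (X 1) = X 1 := by simp [shiftDown]

lemma shiftDown_X2 (k : ℂ) : shiftDown k (X 2) = X 2 - fPoly k (X 0) (X 1) := by simp [shiftDown]

end

lemma shiftUp_shiftDown (k : ℂ) (p : MvPolynomial (Fin 3) ℂ) :
    shiftUp k (shiftDown k p) = p := by
  have h : (shiftUp k).comp (shiftDown k) = AlgHom.id ℂ _ := by
    ext1 i
    fin_cases i <;>
      simp [shiftUp_X0, shiftUp_X1, shiftUp_X2, shiftDown_X0, shiftDown_X1, shiftDown_X2, map_fPoly]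
  exact DFunLike.congr_fun h p

lemma shiftDown_shiftUp (k : ℂ) (p : MvPolynomial (Fin 3) ℂ) :
    shiftDown k (shiftUp k p) = p := by
  have h : (shiftDown k).comp (shiftUp k) = AlgHom.id ℂ _ := by
    ext1 i
    fin_cases i <;>
      simp [shiftUp_X0, shiftUp_X1, shiftUp_X2, shiftDown_X0, shiftDown_X1, shiftDown_X2, map_fPoly]
  exact DFunLike.congr_fun h p

open MvPolynomial in
/-- The action of the generators of `A_k` on `ℂ[j, l, u]`. -/
def actGen (k : ℂ) : Fin 4 → Module.End ℂ (MvPolynomial (Fin 3) ℂ) :=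
  ![LinearMap.mulLeft ℂ (X 0), (shiftUp k).toLinearMap,
    (shiftDown k).toLinearMap ∘ₗ LinearMap.mulLeft ℂ (X 2), LinearMap.mulLeft ℂ (X 1)]

lemma lift_actGen_rel (k : ℂ) ⦃a b : F⦄ (h : Rel k a b) :
    FreeAlgebra.lift ℂ (actGen k) a = FreeAlgebra.lift ℂ (actGen k) b := by
  have hJ : FreeAlgebra.lift ℂ (actGen k) jF = actGen k 0 := FreeAlgebra.lift_ι_apply _ _
  have hp : FreeAlgebra.lift ℂ (actGen k) gpF = actGen k 1 := FreeAlgebra.lift_ι_apply _ _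
  have hm : FreeAlgebra.lift ℂ (actGen k) gmF = actGen k 2 := FreeAlgebra.lift_ι_apply _ _
  have hL : FreeAlgebra.lift ℂ (actGen k) lF = actGen k 3 := FreeAlgebra.lift_ι_apply _ _
  refine LinearMap.ext fun p => ?_
  cases h with
  | gpgm =>
    have h3 : (3 : Module.End ℂ (MvPolynomial (Fin 3) ℂ)) = algebraMap ℂ _ 3 :=
      (map_ofNat _ 3).symm
    simp only [fF, map_sub, map_mul (FreeAlgebra.lift ℂ (actGen k)), map_pow, AlgHom.commutes,
      map_ofNat, hJ, hp, hm, hL]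
    rw [h3]
    simp only [actGen, Matrix.cons_val, LinearMap.sub_apply, Module.End.mul_apply, pow_two,
      LinearMap.comp_apply, LinearMap.mulLeft_apply, AlgHom.toLinearMap_apply,
      Module.algebraMap_end_apply, shiftUp_shiftDown, MvPolynomial.smul_eq_C_mul]
    simp only [map_mul (shiftDown k), shiftDown_shiftUp, shiftDown_X2, fPoly, map_ofNat]
    ring
  | _ =>
    simp only [map_sub, map_neg, map_mul (FreeAlgebra.lift ℂ (actGen k)), hJ, hp, hm, hL]
    simp only [actGen, Matrix.cons_val, LinearMap.sub_apply, LinearMap.neg_apply,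
      Module.End.mul_apply, LinearMap.comp_apply, LinearMap.mulLeft_apply,
      AlgHom.toLinearMap_apply, map_mul (shiftUp k), map_mul (shiftDown k), shiftUp_X0,
      shiftUp_X1, shiftDown_X0, shiftDown_X1] <;>
    ring

/-- The representation of `A_k` on `ℂ[j, l, u]` where `J`, `L`, `G⁺G⁻` act as multiplication by
`j`, `l`, `u`. -/
def act (k : ℂ) : A k →ₐ[ℂ] Module.End ℂ (MvPolynomial (Fin 3) ℂ) :=
  RingQuot.liftAlgHom ℂ ⟨FreeAlgebra.lift ℂ (actGen k), lift_actGen_rel k⟩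

lemma act_mk_ι (k : ℂ) (i : Fin 4) : act k (mk k (FreeAlgebra.ι ℂ i)) = actGen k i := by
  have h : act k (mk k (FreeAlgebra.ι ℂ i)) =
      FreeAlgebra.lift ℂ (actGen k) (FreeAlgebra.ι ℂ i) :=
    RingQuot.liftAlgHom_mkAlgHom_apply ..
  rw [h, FreeAlgebra.lift_ι_apply]

open MvPolynomial in
lemma act_mono (k : ℂ) (q : ℕ × ℕ × ℕ) :
    act k (mono k q) 1 = X 0 ^ q.1 * X 1 ^ q.2.1 * X 2 ^ q.2.2 := by
  have hJ : act k (J k) = LinearMap.mulLeft ℂ (X 0) := act_mk_ι k 0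
  have hL : act k (L k) = LinearMap.mulLeft ℂ (X 1) := act_mk_ι k 3
  have hU : act k (Gp k * Gm k) = LinearMap.mulLeft ℂ (X 2) := by
    have hp : act k (Gp k) = (shiftUp k).toLinearMap := act_mk_ι k 1
    have hm : act k (Gm k) = (shiftDown k).toLinearMap ∘ₗ LinearMap.mulLeft ℂ (X 2) :=
      act_mk_ι k 2
    rw [map_mul, hp, hm]
    exact LinearMap.ext fun p => shiftUp_shiftDown k _
  rw [mono, map_mul, map_mul, map_pow, map_pow, map_pow, hJ, hL, hU]
  simp [LinearMap.pow_mulLeft, mul_assoc]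

lemma linearIndependent_mono (k : ℂ) : LinearIndependent ℂ (mono k) := by
  let φ : A k →ₗ[ℂ] MvPolynomial (Fin 3) ℂ := LinearMap.applyₗ 1 ∘ₗ (act k).toLinearMap
  let e : ℕ × ℕ × ℕ → (Fin 3 →₀ ℕ) := fun q => Finsupp.equivFunOnFinite.symm ![q.1, q.2.1, q.2.2]
  have he : Function.Injective e := by
    rintro ⟨a, b, c⟩ ⟨a', b', c'⟩ h
    have h' := Finsupp.equivFunOnFinite.symm.injective h
    have h0 := congrFun h' 0
    have h1 := congrFun h' 1
    have h2 := congrFun h' 2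
    simp_all
  have hφ : φ ∘ mono k = MvPolynomial.basisMonomials (Fin 3) ℂ ∘ e := by
    funext q
    change act k (mono k q) 1 = _
    rw [act_mono, Function.comp_apply, MvPolynomial.coe_basisMonomials]
    simp [e, MvPolynomial.monomial_eq, Finsupp.prod_fintype, Fin.prod_univ_three]
  refine LinearIndependent.of_comp φ ?_
  rw [hφ]
  exact (MvPolynomial.basisMonomials (Fin 3) ℂ).linearIndependent.comp e he

/-- the centraliser `C_k` of `{J, L}` in `A_k` is exactly the subalgebra
generated by `J`, `L` and `G⁺G⁻`; it is commutative; the monomials `J^a L^b (G⁺G⁻)^c`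
form a `ℂ`-basis of it; and it also equals the subalgebra generated by `J`, `L` and `Ω`. -/
theorem centralizer_of_JL (k : ℂ) :
    (Subalgebra.centralizer ℂ ({J k, L k} : Set (A k))
        = Algebra.adjoin ℂ ({J k, L k, Gp k * Gm k} : Set (A k))) ∧
    (∀ x ∈ Subalgebra.centralizer ℂ ({J k, L k} : Set (A k)),
      ∀ y ∈ Subalgebra.centralizer ℂ ({J k, L k} : Set (A k)), x * y = y * x) ∧
    LinearIndependent ℂ
      (fun q : ℕ × ℕ × ℕ => J k ^ q.1 * L k ^ q.2.1 * (Gp k * Gm k) ^ q.2.2) ∧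
    Submodule.span ℂ
        (Set.range (fun q : ℕ × ℕ × ℕ => J k ^ q.1 * L k ^ q.2.1 * (Gp k * Gm k) ^ q.2.2))
      = Subalgebra.toSubmodule (Subalgebra.centralizer ℂ ({J k, L k} : Set (A k))) ∧
    (Subalgebra.centralizer ℂ ({J k, L k} : Set (A k))
        = Algebra.adjoin ℂ ({J k, L k, Omega k} : Set (A k))) := by
  have hC := centralizer_eq_weightZero k
  refine ⟨hC, ?_, linearIndependent_mono k, ?_, hC.trans (adjoin_Omega k)⟩
  · intro x hx y hy
    rw [hC] at hx hy
    exact weightZero_comm k hx hy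
  · rw [hC]
    exact span_mono k

end BP
end
end
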